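/- arXiv:2512.04719 — 7 statements merged into one kernel-verified Lean document; each statement's English description precedes it below -/
import Mathlib

section
/- Let ρ > 0, η > 0, μ² > 0, β ≥ 0, x₀ ∈ ℝ and C > 0. Then the average-SNR function Γ̄(x) = ρ·(η·exp(−β·((x₀ − x)² + C)) + μ²)/((x₀ − x)² + C) is quasiconcave on ℝ, i.e., for every t ∈ ℝ the superlevel set {x ∈ ℝ : Γ̄(x) ≥ t} is convex. -/
/-- The average SNR as a function of the squared distance `s` is decreasing on `(0, ∞)`. -/
theorem antitoneOn_snr {ρ η μ2 β : ℝ} (hρ : 0 ≤ ρ) (hη : 0 ≤ η) (hμ : 0 ≤ μ2) (hβ : 0 ≤ β) :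
    AntitoneOn (fun s : ℝ => ρ * (η * Real.exp (-β * s) + μ2) / s) (Set.Ioi 0) := by
  intro a ha b _ hab
  have ha' : 0 < a := ha
  have hexp : Real.exp (-β * b) ≤ Real.exp (-β * a) :=
    Real.exp_le_exp.mpr (mul_le_mul_of_nonpos_left hab (neg_nonpos.mpr hβ))
  dsimp only
  gcongr

/-- The average-SNR function
`Γ̄(x) = ρ·(η·exp(−β·((x₀ − x)² + C)) + μ²)/((x₀ − x)² + C)` is quasiconcave:
every superlevel set is convex. -/
theorem avg_snr_quasiconcave (ρ η μ2 β x₀ C : ℝ)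
    (hρ : 0 < ρ) (hη : 0 < η) (hμ : 0 < μ2) (hβ : 0 ≤ β) (hC : 0 < C) :
    ∀ t : ℝ, Convex ℝ {x : ℝ |
      ρ * (η * Real.exp (-β * ((x₀ - x) ^ 2 + C)) + μ2) /
        ((x₀ - x) ^ 2 + C) ≥ t} := by
  intro t
  refine Set.OrdConnected.convex ⟨fun x hx z hz y hy => ?_⟩
  simp only [Set.mem_ofPred_eq] at hx hz ⊢
  have hpos (w : ℝ) : (x₀ - w) ^ 2 + C ∈ Set.Ioi (0 : ℝ) := by
    simp only [Set.mem_Ioi]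
    positivity
  have hanti := antitoneOn_snr hρ.le hη.le hμ.le hβ
  rcases le_total y x₀ with h | h
  · exact hx.le.trans (hanti (hpos y) (hpos x) (by nlinarith [hy.1]))
  · exact hz.le.trans (hanti (hpos y) (hpos z) (by nlinarith [hy.2]))
end

section
/- Let M ≥ 1, D_x > 0, and for each m ∈ {1,…,M} let ρ_m > 0, μ_m² > 0, x_m ∈ ℝ, C_m > 0, with common constants η > 0 and β ≥ 0, and define Γ̄_m(x) = ρ_m·(η·exp(−β·((x_m − x)² + C_m)) + μ_m²)/((x_m − x)² + C_m). For t ∈ ℝ define the global feasibility set F(t) = {x ∈ [0, D_x] : Γ̄_m(x) ≥ t for all m}. Then: (i) F(t) is a convex subset of ℝ; (ii) F(t) is closed; and (iii) F is antitone in t, i.e., t₁ ≤ t₂ implies F(t₂) ⊆ F(t₁). -/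
/-- The average SNR as a function of the squared distance is antitone on the positive reals. -/
theorem antitoneOn_avgSNR {ρ η β ν : ℝ} (hρ : 0 ≤ ρ) (hη : 0 ≤ η) (hβ : 0 ≤ β) (hν : 0 ≤ ν) :
    AntitoneOn (fun r : ℝ => ρ * (η * Real.exp (-β * r) + ν) / r) (Set.Ioi 0) := by
  intro r hr s _ hrs
  have hr' : 0 < r := hr
  have hexp : Real.exp (-β * s) ≤ Real.exp (-β * r) :=
    Real.exp_le_exp.2 (by nlinarith)
  dsimp only
  gcongr

theorem sq_sub_le_max_of_mem_Icc {a b x : ℝ} (c : ℝ) (hx : x ∈ Set.Icc a b) :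
    (c - x) ^ 2 ≤ max ((c - a) ^ 2) ((c - b) ^ 2) := by
  obtain ⟨hax, hxb⟩ := hx
  rcases le_total x c with h | h
  · exact le_max_of_le_left (by nlinarith)
  · exact le_max_of_le_right (by nlinarith)

/-- Superlevel sets of an antitone function of `(c - x) ^ 2 + d` are convex. -/
theorem convex_superlevel_of_antitoneOn {g : ℝ → ℝ} (hg : AntitoneOn g (Set.Ioi 0))
    {d : ℝ} (hd : 0 < d) (c t : ℝ) : Convex ℝ {x : ℝ | t ≤ g ((c - x) ^ 2 + d)} := by
  refine Set.OrdConnected.convex ⟨fun a ha b hb x hx => ?_⟩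
  have hpos : ∀ y : ℝ, (c - y) ^ 2 + d ∈ Set.Ioi (0 : ℝ) := fun y =>
    Set.mem_Ioi.2 (by positivity)
  rcases le_max_iff.1 (sq_sub_le_max_of_mem_Icc c hx) with h | h
  · exact le_trans ha (hg (hpos x) (hpos a) (by gcongr))
  · exact le_trans hb (hg (hpos x) (hpos b) (by gcongr))

/-- Proposition 1: for the multiuser feasibility set
`F(t) = {x ∈ [0, Dₓ] : Γ̄ₘ(x) ≥ t for all m}`, each `F(t)` is convex and
closed, and the family is antitone in `t`. -/
theorem global_feasibility_set_structure (M : ℕ) (hM : 1 ≤ M) (Dx : ℝ)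
    (hDx : 0 < Dx) (ρ μ2 xu C : Fin M → ℝ) (η β : ℝ)
    (hρ : ∀ m, 0 < ρ m) (hμ : ∀ m, 0 < μ2 m) (hC : ∀ m, 0 < C m)
    (hη : 0 < η) (hβ : 0 ≤ β)
    (F : ℝ → Set ℝ)
    (hF : ∀ t, F t = {x : ℝ | x ∈ Set.Icc (0 : ℝ) Dx ∧ ∀ m : Fin M,
      ρ m * (η * Real.exp (-β * ((xu m - x) ^ 2 + C m)) + μ2 m) /
        ((xu m - x) ^ 2 + C m) ≥ t}) :
    (∀ t, Convex ℝ (F t)) ∧ (∀ t, IsClosed (F t)) ∧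
    (∀ t₁ t₂ : ℝ, t₁ ≤ t₂ → F t₂ ⊆ F t₁) := by
  have hF' : ∀ t, F t = Set.Icc 0 Dx ∩ ⋂ m, {x : ℝ | t ≤
      ρ m * (η * Real.exp (-β * ((xu m - x) ^ 2 + C m)) + μ2 m) / ((xu m - x) ^ 2 + C m)} := by
    intro t
    ext x
    simp [hF t]
  refine ⟨fun t => ?_, fun t => ?_, fun t₁ t₂ ht => ?_⟩
  · rw [hF']
    exact (convex_Icc 0 Dx).inter (convex_iInter fun m =>
      convex_superlevel_of_antitoneOn
        (antitoneOn_avgSNR (hρ m).le hη.le hβ (hμ m).le) (hC m) (xu m) t)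
  · rw [hF']
    refine isClosed_Icc.inter (isClosed_iInter fun m => isClosed_le continuous_const ?_)
    have hne : ∀ x : ℝ, (xu m - x) ^ 2 + C m ≠ 0 := fun x =>
      (add_pos_of_nonneg_of_pos (sq_nonneg _) (hC m)).ne'
    exact Continuous.div (by fun_prop) (by fun_prop) hne
  · rw [hF, hF]
    exact fun x hx => ⟨hx.1, fun m => ht.trans (hx.2 m)⟩
end

section
/- Let C₁, C₂ ∈ ℝ and Δ > 0 with Δ² > |C₁ − C₂|. Then α* = Δ²/4 + (C₁ + C₂)/2 + (C₁ − C₂)²/(4Δ²) satisfies α* ≥ max(C₁, C₂) and √(α* − C₁) + √(α* − C₂) = Δ; moreover α* is the unique real number α ≥ max(C₁, C₂) satisfying √(α − C₁) + √(α − C₂) = Δ. -/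
/-- For `Δ > 0` with `Δ² > |C₁ − C₂|`, the value
`α* = Δ²/4 + (C₁ + C₂)/2 + (C₁ − C₂)²/(4Δ²)` satisfies `α* ≥ max(C₁, C₂)` and
`√(α* − C₁) + √(α* − C₂) = Δ`, and it is the unique such root. -/
theorem two_user_alpha_star (C₁ C₂ Δ : ℝ) (hΔ : 0 < Δ)
    (hsep : |C₁ - C₂| < Δ ^ 2) :
    max C₁ C₂ ≤ Δ ^ 2 / 4 + (C₁ + C₂) / 2 + (C₁ - C₂) ^ 2 / (4 * Δ ^ 2) ∧
    Real.sqrt (Δ ^ 2 / 4 + (C₁ + C₂) / 2 + (C₁ - C₂) ^ 2 / (4 * Δ ^ 2) - C₁) +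
      Real.sqrt (Δ ^ 2 / 4 + (C₁ + C₂) / 2 + (C₁ - C₂) ^ 2 / (4 * Δ ^ 2) - C₂)
        = Δ ∧
    ∀ α : ℝ, max C₁ C₂ ≤ α →
      Real.sqrt (α - C₁) + Real.sqrt (α - C₂) = Δ →
      α = Δ ^ 2 / 4 + (C₁ + C₂) / 2 + (C₁ - C₂) ^ 2 / (4 * Δ ^ 2) := by
  obtain ⟨hlo, hhi⟩ := abs_lt.mp hsep
  have h₁ : Δ ^ 2 / 4 + (C₁ + C₂) / 2 + (C₁ - C₂) ^ 2 / (4 * Δ ^ 2) - C₁ =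
      ((Δ ^ 2 - (C₁ - C₂)) / (2 * Δ)) ^ 2 := by
    field_simp
    ring
  have h₂ : Δ ^ 2 / 4 + (C₁ + C₂) / 2 + (C₁ - C₂) ^ 2 / (4 * Δ ^ 2) - C₂ =
      ((Δ ^ 2 + (C₁ - C₂)) / (2 * Δ)) ^ 2 := by
    field_simp
    ring
  refine ⟨max_le (sub_nonneg.mp (h₁ ▸ sq_nonneg _)) (sub_nonneg.mp (h₂ ▸ sq_nonneg _)),
    ?_, fun α hα h => ?_⟩
  · rw [h₁, h₂, Real.sqrt_sq (div_nonneg (by linarith) (by linarith)),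
      Real.sqrt_sq (div_nonneg (by linarith) (by linarith))]
    field_simp
    ring
  · obtain ⟨hα₁, hα₂⟩ := max_le_iff.mp hα
    have hs := Real.sq_sqrt (sub_nonneg.mpr hα₁)
    have ht := Real.sq_sqrt (sub_nonneg.mpr hα₂)
    generalize √(α - C₁) = s at h hs
    generalize √(α - C₂) = t at h ht
    obtain rfl : C₁ = α - s ^ 2 := by linarith
    obtain rfl : C₂ = α - t ^ 2 := by linarith
    subst h
    field_simp
    ring
end

section
/- Let x₁ ≤ x₂ be reals, Δ = x₂ − x₁, and C₁ ≤ C₂ reals with Δ² ≤ C₂ − C₁. Then for every x ∈ ℝ, max((x₁ − x)² + C₁, (x₂ − x)² + C₂) ≥ C₂, and equality holds if and only if x = x₂. -/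
/-- Closely-spaced regime of Lemma 1: if `(x₂ − x₁)² ≤ C₂ − C₁` with
`x₁ ≤ x₂` and `C₁ ≤ C₂`, then for every antenna position `x` the worst-case
squared distance is at least `C₂`, with equality iff `x = x₂`. -/
theorem closely_spaced_worst_distance (x₁ x₂ C₁ C₂ : ℝ)
    (hx : x₁ ≤ x₂) (hC : C₁ ≤ C₂) (h : (x₂ - x₁) ^ 2 ≤ C₂ - C₁) :
    ∀ x : ℝ,
      C₂ ≤ max ((x₁ - x) ^ 2 + C₁) ((x₂ - x) ^ 2 + C₂) ∧
      (max ((x₁ - x) ^ 2 + C₁) ((x₂ - x) ^ 2 + C₂) = C₂ ↔ x = x₂) := by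
  intro x
  refine ⟨le_max_of_le_right (le_add_of_nonneg_left (sq_nonneg _)), fun hmax => ?_, ?_⟩
  · have hle : (x₂ - x) ^ 2 + C₂ ≤ C₂ := (le_max_right _ _).trans_eq hmax
    have hsq : (x₂ - x) ^ 2 = 0 := le_antisymm (by linarith) (sq_nonneg _)
    exact (sub_eq_zero.mp (pow_eq_zero_iff two_ne_zero |>.mp hsq)).symm
  · rintro rfl
    rw [max_eq_right] <;> nlinarith
end

section
/- Let x₁ ≤ x₂ be reals, Δ = x₂ − x₁ > 0, and C₁, C₂ reals with Δ² > |C₁ − C₂|. Define α* = Δ²/4 + (C₁ + C₂)/2 + (C₁ − C₂)²/(4Δ²) and x* = (x₁ + x₂)/2 + (C₂ − C₁)/(2Δ). Then for every x ∈ ℝ, max((x₁ − x)² + C₁, (x₂ − x)² + C₂) ≥ α*, and equality holds if and only if x = x*. -/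
/-- Quadratic growth of the maximum of two parabolas around a crossing point that lies between
their vertices, written in the displacement `t` from that point. -/
theorem add_sq_le_max_of_nonneg {a p q : ℝ} (hp : 0 ≤ p) (hq : 0 ≤ q) (t : ℝ) :
    a + t ^ 2 ≤ max (a + 2 * p * t + t ^ 2) (a - 2 * q * t + t ^ 2) := by
  rcases le_total 0 t with ht | ht
  · exact le_max_of_le_left (by nlinarith [mul_nonneg hp ht])
  · exact le_max_of_le_right (by nlinarith [mul_nonneg_of_nonpos_of_nonpos (neg_nonpos.2 hq) ht])

/-- Well-separated regime of Lemma 1: if `Δ = x₂ − x₁ > 0` and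
`Δ² > |C₁ − C₂|`, then with `α* = Δ²/4 + (C₁ + C₂)/2 + (C₁ − C₂)²/(4Δ²)` and
`x* = (x₁ + x₂)/2 + (C₂ − C₁)/(2Δ)`, the worst-case squared distance is at
least `α*` for every `x`, with equality iff `x = x*`. -/
theorem well_separated_worst_distance (x₁ x₂ C₁ C₂ : ℝ)
    (hx : x₁ ≤ x₂) (hΔ : 0 < x₂ - x₁) (hsep : |C₁ - C₂| < (x₂ - x₁) ^ 2) :
    ∀ x : ℝ,
      (x₂ - x₁) ^ 2 / 4 + (C₁ + C₂) / 2 +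
          (C₁ - C₂) ^ 2 / (4 * (x₂ - x₁) ^ 2) ≤
        max ((x₁ - x) ^ 2 + C₁) ((x₂ - x) ^ 2 + C₂) ∧
      (max ((x₁ - x) ^ 2 + C₁) ((x₂ - x) ^ 2 + C₂) =
          (x₂ - x₁) ^ 2 / 4 + (C₁ + C₂) / 2 +
            (C₁ - C₂) ^ 2 / (4 * (x₂ - x₁) ^ 2) ↔
        x = (x₁ + x₂) / 2 + (C₂ - C₁) / (2 * (x₂ - x₁))) := by
  intro x
  obtain ⟨k, hk⟩ : ∃ k, k = (C₂ - C₁) / (2 * (x₂ - x₁)) := ⟨_, rfl⟩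
  have hC : C₂ = C₁ + 2 * (x₂ - x₁) * k := by
    rw [hk]
    field_simp
    ring
  have hsq : (C₁ - C₂) ^ 2 / (4 * (x₂ - x₁) ^ 2) = k ^ 2 := by
    rw [hk]
    field_simp
    ring
  obtain ⟨hlo, hhi⟩ := abs_lt.1 hsep
  have hp : 0 < (x₂ - x₁) / 2 + k := by
    refine pos_of_mul_pos_right (a := x₂ - x₁) ?_ hΔ.le
    linarith
  have hq : 0 < (x₂ - x₁) / 2 - k := by
    refine pos_of_mul_pos_right (a := x₂ - x₁) ?_ hΔ.le
    linarith
  rw [hsq, ← hk]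
  set a := (x₂ - x₁) ^ 2 / 4 + (C₁ + C₂) / 2 + k ^ 2 with ha
  set t := x - ((x₁ + x₂) / 2 + k) with ht
  have h₁ : (x₁ - x) ^ 2 + C₁ = a + 2 * ((x₂ - x₁) / 2 + k) * t + t ^ 2 := by
    rw [ha, ht, hC]
    ring
  have h₂ : (x₂ - x) ^ 2 + C₂ = a - 2 * ((x₂ - x₁) / 2 - k) * t + t ^ 2 := by
    rw [ha, ht, hC]
    ring
  rw [h₁, h₂]
  have hgrowth := add_sq_le_max_of_nonneg (a := a) hp.le hq.le t
  refine ⟨by linarith [sq_nonneg t], fun h => ?_, fun h => ?_⟩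
  · have ht0 : t = 0 := pow_eq_zero_iff two_ne_zero |>.1 <|
      le_antisymm (by linarith) (sq_nonneg t)
    linarith
  · have ht0 : t = 0 := by linarith
    simp [ht0]
end

section
/- Let ρ > 0, η > 0, μ² > 0, β ≥ 0 and f(y) = ρ·(η·exp(−β·y) + μ²)/y. Let x₁ ≤ x₂, Δ = x₂ − x₁ > 0, and C₁, C₂ > 0 with Δ² > |C₁ − C₂|. Define α* = Δ²/4 + (C₁ + C₂)/2 + (C₁ − C₂)²/(4Δ²) and x* = (x₁ + x₂)/2 + (C₂ − C₁)/(2Δ). Then for every x ∈ ℝ, min(f((x₁ − x)² + C₁), f((x₂ − x)² + C₂)) ≤ f(α*), and equality holds at x = x*; i.e., x* maximizes the minimum average SNR of the two users and the optimal value is t* = ρ·(η·exp(−β·α*) + μ²)/α*. -/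
/-- The average SNR `ρ·(η·exp(−β·y) + μ²)/y` is nonincreasing in the squared distance `y > 0`. -/
theorem snr_antitoneOn {ρ η μ2 β : ℝ} (hρ : 0 ≤ ρ) (hη : 0 ≤ η) (hμ : 0 ≤ μ2) (hβ : 0 ≤ β) :
    AntitoneOn (fun y : ℝ => ρ * (η * Real.exp (-β * y) + μ2) / y) (Set.Ioi 0) := by
  intro a ha b _ hab
  have ha' : 0 < a := ha
  have hexp : Real.exp (-β * b) ≤ Real.exp (-β * a) :=
    Real.exp_le_exp.2 (mul_le_mul_of_nonpos_left hab (neg_nonpos.2 hβ))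
  dsimp only
  gcongr

/-- Well-separated case of Lemma 1: with `f(y) = ρ·(η·exp(−β·y) + μ²)/y`,
`α* = Δ²/4 + (C₁ + C₂)/2 + (C₁ − C₂)²/(4Δ²)` and
`x* = (x₁ + x₂)/2 + (C₂ − C₁)/(2Δ)`, the position `x*` maximizes the minimum
average SNR of the two users and the optimal value is `f(α*)`. -/
theorem two_user_maxmin_well_separated (ρ η μ2 β x₁ x₂ C₁ C₂ : ℝ)
    (hρ : 0 < ρ) (hη : 0 < η) (hμ : 0 < μ2) (hβ : 0 ≤ β)
    (hx : x₁ ≤ x₂) (hΔ : 0 < x₂ - x₁)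
    (hC₁ : 0 < C₁) (hC₂ : 0 < C₂) (hsep : |C₁ - C₂| < (x₂ - x₁) ^ 2)
    (f : ℝ → ℝ) (hf : ∀ y, f y = ρ * (η * Real.exp (-β * y) + μ2) / y)
    (αstar xstar : ℝ)
    (hαstar : αstar = (x₂ - x₁) ^ 2 / 4 + (C₁ + C₂) / 2 +
      (C₁ - C₂) ^ 2 / (4 * (x₂ - x₁) ^ 2))
    (hxstar : xstar = (x₁ + x₂) / 2 + (C₂ - C₁) / (2 * (x₂ - x₁))) :
    (∀ x : ℝ, min (f ((x₁ - x) ^ 2 + C₁)) (f ((x₂ - x) ^ 2 + C₂)) ≤ f αstar) ∧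
    min (f ((x₁ - xstar) ^ 2 + C₁)) (f ((x₂ - xstar) ^ 2 + C₂)) = f αstar ∧
    f αstar = ρ * (η * Real.exp (-β * αstar) + μ2) / αstar := by
  have hΔ0 : x₂ - x₁ ≠ 0 := hΔ.ne'
  have h₁ : (x₁ - xstar) ^ 2 + C₁ = αstar := by
    rw [hxstar, hαstar]
    field_simp
    ring
  have h₂ : (x₂ - xstar) ^ 2 + C₂ = αstar := by
    rw [hxstar, hαstar]
    field_simp
    ring
  have hα : 0 < αstar := by
    rw [← h₁]
    positivity
  have hmono : ∀ y, αstar ≤ y → f y ≤ f αstar := fun y hy => by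
    rw [hf, hf]
    exact snr_antitoneOn hρ.le hη.le hμ.le hβ hα (hα.trans_le hy) hy
  obtain ⟨hlo, hhi⟩ := abs_lt.1 hsep
  have hleft : x₁ ≤ xstar := by
    have h : xstar - x₁ = ((x₂ - x₁) ^ 2 + (C₂ - C₁)) / (2 * (x₂ - x₁)) := by
      rw [hxstar]
      field_simp
      ring
    exact sub_nonneg.1 (h ▸ div_nonneg (by linarith) (by linarith))
  have hright : xstar ≤ x₂ := by
    have h : x₂ - xstar = ((x₂ - x₁) ^ 2 - (C₂ - C₁)) / (2 * (x₂ - x₁)) := by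
      rw [hxstar]
      field_simp
      ring
    exact sub_nonneg.1 (h ▸ div_nonneg (by linarith) (by linarith))
  refine ⟨fun x => ?_, by rw [h₁, h₂, min_self], hf αstar⟩
  rcases le_total xstar x with hxx | hxx
  · exact (min_le_left _ _).trans (hmono _ (by nlinarith))
  · exact (min_le_right _ _).trans (hmono _ (by nlinarith))
end

section
/- Let a ≥ 0, k > 0 and β ≥ 0, and define Q₁(a, b) = ∫_b^∞ x·exp(−(x² + a²)/2)·I₀(a·x) dx with I₀(t) = (1/π)·∫₀^π exp(t·cos θ) dθ. Then the function g(y) = exp(−β·y)·Q₁(a, √(2·k·y)) + (1 − exp(−β·y))·exp(−k·y) is strictly decreasing on (0, ∞). -/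
open MeasureTheory

/-- The modified Bessel function of the first kind of order zero, by its integral formula. -/
noncomputable def besselIZero (t : ℝ) : ℝ :=
  (1 / Real.pi) * ∫ θ in (0 : ℝ)..Real.pi, Real.exp (t * Real.cos θ)

/-- The probability density of the Rice distribution with noncentrality `a`. -/
noncomputable def riceDensity (a x : ℝ) : ℝ :=
  x * Real.exp (-(x ^ 2 + a ^ 2) / 2) * besselIZero (a * x)

lemma intervalIntegral_cos_neg (F : ℝ → ℝ) :
    ∫ θ in (0 : ℝ)..Real.pi, F (-Real.cos θ) = ∫ θ in (0 : ℝ)..Real.pi, F (Real.cos θ) := by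
  simpa [Real.cos_pi_sub] using
    intervalIntegral.integral_comp_sub_left (a := 0) (b := Real.pi)
      (fun θ => F (Real.cos θ)) Real.pi

lemma besselIZero_eq_cosh (t : ℝ) :
    besselIZero t = (1 / Real.pi) * ∫ θ in (0 : ℝ)..Real.pi, Real.cosh (t * Real.cos θ) := by
  have hneg := intervalIntegral_cos_neg (fun c => Real.exp (t * c))
  have hsum : ∫ θ in (0 : ℝ)..Real.pi, Real.cosh (t * Real.cos θ) =
      ((∫ θ in (0 : ℝ)..Real.pi, Real.exp (t * Real.cos θ)) +
        ∫ θ in (0 : ℝ)..Real.pi, Real.exp (t * -Real.cos θ)) / 2 := by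
    rw [← intervalIntegral.integral_add
      (Continuous.intervalIntegrable (by fun_prop) _ _)
      (Continuous.intervalIntegrable (by fun_prop) _ _),
      ← intervalIntegral.integral_div]
    simp only [Real.cosh_eq, mul_neg]
  rw [hsum, hneg, besselIZero]
  ring

lemma besselIZero_le_of_abs_le {s t : ℝ} (h : |s| ≤ |t|) : besselIZero s ≤ besselIZero t := by
  rw [besselIZero_eq_cosh, besselIZero_eq_cosh]
  refine mul_le_mul_of_nonneg_left ?_ (by positivity)
  refine intervalIntegral.integral_mono_on Real.pi_pos.le
    (Continuous.intervalIntegrable (by fun_prop) _ _)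
    (Continuous.intervalIntegrable (by fun_prop) _ _) fun θ _ => ?_
  rw [Real.cosh_le_cosh, abs_mul, abs_mul]
  gcongr

lemma besselIZero_pos (t : ℝ) : 0 < besselIZero t := by
  refine mul_pos (by positivity) ?_
  exact intervalIntegral.intervalIntegral_pos_of_pos
    (Continuous.intervalIntegrable (by fun_prop) _ _) (fun _ => Real.exp_pos _) Real.pi_pos

lemma riceDensity_pos (a : ℝ) {x : ℝ} (hx : 0 < x) : 0 < riceDensity a x :=
  mul_pos (mul_pos hx (Real.exp_pos _)) (besselIZero_pos _)

lemma integral_exp_mul_cos_eq_besselIZero (t : ℝ) :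
    ∫ θ in Set.Ioo (-Real.pi) Real.pi, Real.exp (t * Real.cos θ) =
      2 * Real.pi * besselIZero t := by
  have hi : ∀ u v : ℝ, IntervalIntegrable (fun θ => Real.exp (t * Real.cos θ)) volume u v :=
    fun u v => Continuous.intervalIntegrable (by fun_prop) _ _
  have hneg : ∫ θ in (-Real.pi)..0, Real.exp (t * Real.cos θ) =
      ∫ θ in (0 : ℝ)..Real.pi, Real.exp (t * Real.cos θ) := by
    simpa using (intervalIntegral.integral_comp_neg (a := 0) (b := Real.pi)
      (fun θ => Real.exp (t * Real.cos θ))).symm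
  rw [← integral_Ioc_eq_integral_Ioo, ← intervalIntegral.integral_of_le
    (by linarith [Real.pi_pos]), ← intervalIntegral.integral_add_adjacent_intervals (hi _ 0) (hi 0 _),
    hneg, besselIZero]
  field_simp
  ring

lemma integral_gaussian_shifted_prod (a : ℝ) :
    ∫ p : ℝ × ℝ, Real.exp (-(1 / 2) * (p.1 - a) ^ 2) * Real.exp (-(1 / 2) * p.2 ^ 2) =
      2 * Real.pi := by
  rw [Measure.volume_eq_prod, integral_prod_mul (fun x : ℝ => Real.exp (-(1 / 2) * (x - a) ^ 2))
    (fun x : ℝ => Real.exp (-(1 / 2) * x ^ 2)),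
    integral_sub_right_eq_self (fun x : ℝ => Real.exp (-(1 / 2) * x ^ 2)) a,
    integral_gaussian, Real.mul_self_sqrt (by positivity)]
  ring

lemma integral_rice_polar (a : ℝ) :
    ∫ p in Set.Ioi (0 : ℝ) ×ˢ Set.Ioo (-Real.pi) Real.pi,
      p.1 * Real.exp (-(p.1 ^ 2 + a ^ 2) / 2) * Real.exp (a * p.1 * Real.cos p.2) =
      2 * Real.pi := by
  rw [← integral_gaussian_shifted_prod a, ← integral_comp_polarCoord_symm]
  refine integral_congr_ae (Filter.Eventually.of_forall fun p => ?_)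
  simp only [polarCoord_symm_apply, smul_eq_mul]
  rw [mul_assoc, ← Real.exp_add, ← Real.exp_add]
  congr 2
  linear_combination (-p.1 ^ 2 / 2) * (Real.sin_sq_add_cos_sq p.2).symm

lemma integrableOn_rice_polar (a : ℝ) :
    IntegrableOn (fun p : ℝ × ℝ =>
        p.1 * Real.exp (-(p.1 ^ 2 + a ^ 2) / 2) * Real.exp (a * p.1 * Real.cos p.2))
      (Set.Ioi (0 : ℝ) ×ˢ Set.Ioo (-Real.pi) Real.pi) := by
  by_contra h
  have := integral_rice_polar a
  rw [integral_undef h] at this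
  linarith [Real.pi_pos]

lemma integral_rice_angle (a x : ℝ) :
    ∫ θ in Set.Ioo (-Real.pi) Real.pi,
      x * Real.exp (-(x ^ 2 + a ^ 2) / 2) * Real.exp (a * x * Real.cos θ) =
      2 * Real.pi * riceDensity a x := by
  rw [integral_const_mul, integral_exp_mul_cos_eq_besselIZero, riceDensity]
  ring

lemma integrableOn_riceDensity (a : ℝ) : IntegrableOn (riceDensity a) (Set.Ioi 0) := by
  have h := integrableOn_rice_polar a
  rw [IntegrableOn, Measure.volume_eq_prod, ← Measure.prod_restrict] at h
  have h' := h.integral_prod_left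
  simp only [integral_rice_angle] at h'
  exact (integrable_const_mul_iff (IsUnit.mk0 _ (by positivity)) _).1 h'

lemma integral_riceDensity (a : ℝ) : ∫ x in Set.Ioi (0 : ℝ), riceDensity a x = 1 := by
  have h := integral_rice_polar a
  have hi := integrableOn_rice_polar a
  rw [Measure.volume_eq_prod] at h hi
  rw [setIntegral_prod _ hi] at h
  simp only [integral_rice_angle] at h
  rw [integral_const_mul] at h
  exact mul_left_cancel₀ (by positivity : (2 * Real.pi) ≠ 0) (by rw [h, mul_one])

lemma integrable_mul_exp_neg_sq_div_two :
    Integrable (fun x : ℝ => x * Real.exp (-x ^ 2 / 2)) := by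
  convert integrable_mul_exp_neg_mul_sq (b := 1 / 2) (by norm_num) using 4
  ring

lemma hasDerivAt_neg_exp_neg_sq_div_two (x : ℝ) :
    HasDerivAt (fun x : ℝ => -Real.exp (-x ^ 2 / 2)) (x * Real.exp (-x ^ 2 / 2)) x := by
  have h := ((((hasDerivAt_id x).pow 2).neg.div_const 2).exp).neg
  refine h.congr_deriv ?_
  simp
  ring

lemma intervalIntegral_mul_exp_neg_sq_div_two (b : ℝ) :
    ∫ x in (0 : ℝ)..b, x * Real.exp (-x ^ 2 / 2) = 1 - Real.exp (-b ^ 2 / 2) := by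
  rw [intervalIntegral.integral_eq_sub_of_hasDerivAt
    (fun x _ => hasDerivAt_neg_exp_neg_sq_div_two x)
    integrable_mul_exp_neg_sq_div_two.intervalIntegrable]
  simp
  ring

lemma integral_Ioi_mul_exp_neg_sq_div_two (b : ℝ) :
    ∫ x in Set.Ioi b, x * Real.exp (-x ^ 2 / 2) = Real.exp (-b ^ 2 / 2) := by
  have hlim : Filter.Tendsto (fun x : ℝ => -Real.exp (-x ^ 2 / 2)) Filter.atTop (nhds 0) := by
    rw [← neg_zero]
    refine (Real.tendsto_exp_atBot.comp ?_).neg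
    have : Filter.Tendsto (fun x : ℝ => x ^ 2 / 2) Filter.atTop Filter.atTop :=
      (Filter.tendsto_pow_atTop two_ne_zero).atTop_div_const two_pos
    simpa only [neg_div, Function.comp_def] using Filter.tendsto_neg_atTop_atBot.comp this
  rw [integral_Ioi_of_hasDerivAt_of_tendsto' (fun x _ => hasDerivAt_neg_exp_neg_sq_div_two x)
    integrable_mul_exp_neg_sq_div_two.integrableOn hlim]
  ring

lemma riceDensity_eq_mul (a x : ℝ) :
    riceDensity a x =
      x * Real.exp (-x ^ 2 / 2) * (Real.exp (-a ^ 2 / 2) * besselIZero (a * x)) := by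
  rw [riceDensity, show -(x ^ 2 + a ^ 2) / 2 = -x ^ 2 / 2 + -a ^ 2 / 2 by ring, Real.exp_add]
  ring

lemma integral_Ioi_riceDensity_add (a : ℝ) {b c : ℝ} (hb : 0 ≤ b) (hc : b ≤ c) :
    (∫ x in b..c, riceDensity a x) + ∫ x in Set.Ioi c, riceDensity a x =
      ∫ x in Set.Ioi b, riceDensity a x :=
  intervalIntegral.integral_interval_add_Ioi
    ((integrableOn_riceDensity a).mono_set (Set.Ioi_subset_Ioi hb))
    ((integrableOn_riceDensity a).mono_set (Set.Ioi_subset_Ioi (hb.trans hc)))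

lemma intervalIntegrable_riceDensity (a : ℝ) {b c : ℝ} (hb : 0 ≤ b) (hc : b ≤ c) :
    IntervalIntegrable (riceDensity a) volume b c :=
  (intervalIntegrable_iff_integrableOn_Ioc_of_le hc).2
    ((integrableOn_riceDensity a).mono_set fun _ hx => hb.trans_lt hx.1)

/-- The Rice distribution stochastically dominates the Rayleigh distribution. -/
lemma exp_neg_sq_div_two_le_integral_riceDensity {a b : ℝ} (ha : 0 ≤ a) (hb : 0 ≤ b) :
    Real.exp (-b ^ 2 / 2) ≤ ∫ x in Set.Ioi b, riceDensity a x := by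
  have hmono : ∀ {x y : ℝ}, 0 ≤ x → x ≤ y →
      Real.exp (-a ^ 2 / 2) * besselIZero (a * x) ≤
        Real.exp (-a ^ 2 / 2) * besselIZero (a * y) := by
    intro x y hx hxy
    refine mul_le_mul_of_nonneg_left (besselIZero_le_of_abs_le ?_) (Real.exp_pos _).le
    rw [abs_of_nonneg (by positivity), abs_of_nonneg (mul_nonneg ha (hx.trans hxy))]
    gcongr
  rcases le_total 1 (Real.exp (-a ^ 2 / 2) * besselIZero (a * b)) with h | h
  · rw [← integral_Ioi_mul_exp_neg_sq_div_two]
    refine setIntegral_mono_on integrable_mul_exp_neg_sq_div_two.integrableOn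
      ((integrableOn_riceDensity a).mono_set (Set.Ioi_subset_Ioi hb)) measurableSet_Ioi
      fun x hx => ?_
    rw [riceDensity_eq_mul]
    have hx0 : 0 ≤ x := hb.trans (le_of_lt hx)
    exact le_mul_of_one_le_right (by positivity) (h.trans (hmono hb (le_of_lt hx)))
  · have hsplit := integral_Ioi_riceDensity_add a le_rfl hb
    rw [integral_riceDensity] at hsplit
    have hle : ∫ x in (0 : ℝ)..b, riceDensity a x ≤
        ∫ x in (0 : ℝ)..b, x * Real.exp (-x ^ 2 / 2) := by
      refine intervalIntegral.integral_mono_on hb (intervalIntegrable_riceDensity a le_rfl hb)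
        integrable_mul_exp_neg_sq_div_two.intervalIntegrable fun x hx => ?_
      rw [riceDensity_eq_mul]
      have hx0 : 0 ≤ x := hx.1
      exact mul_le_of_le_one_right (by positivity) ((hmono hx.1 hx.2).trans h)
    rw [intervalIntegral_mul_exp_neg_sq_div_two] at hle
    linarith

lemma integral_Ioi_riceDensity_lt (a : ℝ) {b c : ℝ} (hb : 0 ≤ b) (hc : b < c) :
    ∫ x in Set.Ioi c, riceDensity a x < ∫ x in Set.Ioi b, riceDensity a x := by
  have hpos := intervalIntegral.intervalIntegral_pos_of_pos_on
    (intervalIntegrable_riceDensity a hb hc.le)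
    (fun x hx => riceDensity_pos a (hb.trans_lt hx.1)) hc
  linarith [integral_Ioi_riceDensity_add a hb hc.le]

/-- Distance-monotonicity of the CCDF (Proposition 2): with
`Q₁(a, b) = ∫_b^∞ x·exp(−(x² + a²)/2)·I₀(a·x) dx` and
`I₀(t) = (1/π)·∫₀^π exp(t·cos θ) dθ`, the function
`g(y) = exp(−β·y)·Q₁(a, √(2·k·y)) + (1 − exp(−β·y))·exp(−k·y)` is strictly
decreasing on `(0, ∞)` for `a ≥ 0`, `k > 0`, `β ≥ 0`. -/
theorem ccdf_strictAnti (a k β : ℝ) (ha : 0 ≤ a) (hk : 0 < k) (hβ : 0 ≤ β) :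
    StrictAntiOn (fun y : ℝ =>
        Real.exp (-β * y) *
          (∫ x in Set.Ici (Real.sqrt (2 * k * y)),
            x * Real.exp (-(x ^ 2 + a ^ 2) / 2) *
              ((1 / Real.pi) *
                ∫ θ in (0 : ℝ)..Real.pi, Real.exp (a * x * Real.cos θ)))
        + (1 - Real.exp (-β * y)) * Real.exp (-k * y))
      (Set.Ioi (0 : ℝ)) := by
  intro y hy z hz hyz
  have hy0 : 0 < y := hy
  have hz0 : 0 < z := hz
  have hb : Real.sqrt (2 * k * y) < Real.sqrt (2 * k * z) :=
    Real.sqrt_lt_sqrt (by positivity) (by gcongr)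
  have hQ := integral_Ioi_riceDensity_lt a (Real.sqrt_nonneg _) hb
  have hdom := exp_neg_sq_div_two_le_integral_riceDensity ha (Real.sqrt_nonneg (2 * k * z))
  rw [Real.sq_sqrt (by positivity), show -(2 * k * z) / 2 = -k * z by ring] at hdom
  have hE : Real.exp (-k * z) < Real.exp (-k * y) := Real.exp_lt_exp.2 (by nlinarith)
  have hβle : Real.exp (-β * z) ≤ Real.exp (-β * y) := Real.exp_le_exp.2 (by nlinarith)
  have hβone : Real.exp (-β * y) ≤ 1 := Real.exp_le_one_iff.2 (by nlinarith)
  have hβpos := Real.exp_pos (-β * y)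
  simp only [integral_Ici_eq_integral_Ioi]
  change Real.exp (-β * z) * (∫ x in Set.Ioi (Real.sqrt (2 * k * z)), riceDensity a x)
      + (1 - Real.exp (-β * z)) * Real.exp (-k * z) <
    Real.exp (-β * y) * (∫ x in Set.Ioi (Real.sqrt (2 * k * y)), riceDensity a x)
      + (1 - Real.exp (-β * y)) * Real.exp (-k * y)
  have h₁ := mul_lt_mul_of_pos_left hQ hβpos
  have h₂ := mul_le_mul_of_nonneg_left hE.le (sub_nonneg.2 hβone)
  have h₃ := mul_nonneg (sub_nonneg.2 hβle) (sub_nonneg.2 hdom)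
  linarith
end
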